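/- Let a, b be positive integers and let V ∈ Inc^q(a × b). If a box 𝖻 ≠ (1,1) is in the stream-bed of V, then either the pair {𝖻^←, 𝖻} (with the box immediately to the left of 𝖻) or the pair {𝖻^↑, 𝖻} (with the box immediately above 𝖻) belongs to the flow path of V. Dually, if a box 𝖻 ≠ (a,b) is in the stream-bed of V, then either the pair {𝖻, 𝖻^→} (with the box immediately to the right of 𝖻) or the pair {𝖻, 𝖻^↓} (with the box immediately below 𝖻) belongs to the flow path of V. -/

import Mathlib

open scoped Classical

/-- Two boxes of the `a × b` grid are adjacent if they share an edge. -/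
def Adj {a b : ℕ} (x y : Fin a × Fin b) : Prop :=
  (x.1 = y.1 ∧ ((x.2 : ℕ) + 1 = (y.2 : ℕ) ∨ (y.2 : ℕ) + 1 = (x.2 : ℕ))) ∨
  (x.2 = y.2 ∧ ((x.1 : ℕ) + 1 = (y.1 : ℕ) ∨ (y.1 : ℕ) + 1 = (x.1 : ℕ)))

/-- `IncTab a b q T` says `T` is an increasing tableau of shape `a × b`
(rows strictly increase left-to-right, columns strictly increase top-to-bottom)
with positive entries, all at most `q`; i.e. `T ∈ Inc^q(a × b)`. -/
def IncTab (a b q : ℕ) (T : Fin a × Fin b → ℕ) : Prop :=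
  (∀ x, 1 ≤ T x ∧ T x ≤ q) ∧
  (∀ (i : Fin a) (j₁ j₂ : Fin b), j₁ < j₂ → T (i, j₁) < T (i, j₂)) ∧
  (∀ (i₁ i₂ : Fin a) (j : Fin b), i₁ < i₂ → T (i₁, j) < T (i₂, j))

/-- In the filling `f`, boxes `x` and `y` lie in a common edge-connected
component (short ribbon) of the set of boxes labeled `1` or `t`. -/
def SameRibbon {a b : ℕ} (t : ℕ) (f : Fin a × Fin b → ℕ) (x y : Fin a × Fin b) : Prop :=
  Relation.ReflTransGen
    (fun u v => Adj u v ∧ (f u = 1 ∨ f u = t) ∧ (f v = 1 ∨ f v = t)) x y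

/-- One step of the K-promotion algorithm at value `t`: in every nontrivial
edge-connected component of the set of boxes labeled `1` or `t`, the labels
`1` and `t` are swapped; boxes in trivial components are unchanged. -/
noncomputable def BKstep {a b : ℕ} (t : ℕ) (f : Fin a × Fin b → ℕ) :
    Fin a × Fin b → ℕ := fun x =>
  if ∃ y, y ≠ x ∧ SameRibbon t f x y then
    (if f x = 1 then t else if f x = t then 1 else f x)
  else f x

/-- The intermediate filling obtained from `f` after performing the swap steps
for the values `2, 3, …, t - 1` (so `sweepUpTo t f` is the filling in force
when the step for value `t` is about to be performed). -/
noncomputable def sweepUpTo {a b : ℕ} (t : ℕ) (f : Fin a × Fin b → ℕ) :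
    Fin a × Fin b → ℕ :=
  (List.range' 2 (t - 2)).foldl (fun g s => BKstep s g) f

/-- K-promotion `Ψ : Inc^q(a × b) → Inc^q(a × b)`: perform the swap steps for
`t = 2, …, q`, then decrement every entry by `1`, replacing a resulting `0`
by `q`. -/
noncomputable def KPro {a b : ℕ} (q : ℕ) (T : Fin a × Fin b → ℕ) :
    Fin a × Fin b → ℕ := fun x =>
  if sweepUpTo (q + 1) T x = 1 then q else sweepUpTo (q + 1) T x - 1

/-- The Ψ-orbit of `T` under K-promotion. -/
noncomputable def PsiOrbit {a b : ℕ} (q : ℕ) (T : Fin a × Fin b → ℕ) :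
    Set (Fin a × Fin b → ℕ) :=
  {U | ∃ n : ℕ, (KPro q)^[n] T = U}

/-- The pair `{x, y}` of adjacent boxes belongs to the flow path of `V`:
at the step for some value `t ∈ {2, …, q}`, both boxes carry label `1` or `t`,
so they form part of a common nontrivial short ribbon whose labels are swapped. -/
def FlowPath {a b : ℕ} (q : ℕ) (V : Fin a × Fin b → ℕ) (x y : Fin a × Fin b) : Prop :=
  Adj x y ∧ ∃ t, 2 ≤ t ∧ t ≤ q ∧
    (sweepUpTo t V x = 1 ∨ sweepUpTo t V x = t) ∧
    (sweepUpTo t V y = 1 ∨ sweepUpTo t V y = t)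

/-- The stream-bed of `V`: boxes appearing in some pair of the flow path. -/
def StreamBed {a b : ℕ} (q : ℕ) (V : Fin a × Fin b → ℕ) (x : Fin a × Fin b) : Prop :=
  ∃ y, FlowPath q V x y ∨ FlowPath q V y x

/-- The box `x` lies in the frame of the `a × b` grid (first or last row,
or first or last column). -/
def InFrame {a b : ℕ} (x : Fin a × Fin b) : Prop :=
  (x.1 : ℕ) = 0 ∨ (x.1 : ℕ) = a - 1 ∨ (x.2 : ℕ) = 0 ∨ (x.2 : ℕ) = b - 1

/-- `Frame(V) = Frame(W)`: the fillings agree on all frame boxes. -/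
def FrameEq {a b : ℕ} (V W : Fin a × Fin b → ℕ) : Prop :=
  ∀ x, InFrame x → V x = W x

/-- The minimal tableau `M_{a×b}`, with entries `M(i,j) = i + j - 1`
(in 1-based coordinates; here coordinates are 0-based). -/
def MinTab (a b : ℕ) : Fin a × Fin b → ℕ := fun x => (x.1 : ℕ) + (x.2 : ℕ) + 1

/-- `y` is the box immediately right of, or immediately below, `x`. -/
def Cov {a b : ℕ} (x y : Fin a × Fin b) : Prop :=
  (y.1 = x.1 ∧ (x.2 : ℕ) + 1 = (y.2 : ℕ)) ∨ (y.2 = x.2 ∧ (x.1 : ℕ) + 1 = (y.1 : ℕ))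

theorem adj_iff_cov {a b : ℕ} (x y : Fin a × Fin b) : Adj x y ↔ Cov x y ∨ Cov y x := by
  unfold Adj Cov
  constructor
  · rintro (⟨h, h' | h'⟩ | ⟨h, h' | h'⟩) <;> simp [h, h']
  · rintro ((⟨h, h'⟩ | ⟨h, h'⟩) | (⟨h, h'⟩ | ⟨h, h'⟩)) <;> simp [h, h']

theorem cov_adj {a b : ℕ} {x y : Fin a × Fin b} (h : Cov x y) : Adj x y :=
  (adj_iff_cov x y).2 (Or.inl h)

theorem adj_symm' {a b : ℕ} {x y : Fin a × Fin b} (h : Adj x y) : Adj y x :=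
  (adj_iff_cov y x).2 ((adj_iff_cov x y).1 h).symm

theorem adj_ne {a b : ℕ} {x y : Fin a × Fin b} (h : Adj x y) : y ≠ x := by
  rintro rfl
  unfold Adj at h
  omega

/-- Position of the label `u` in the order in force before step `t`. -/
def labKey (t u : ℕ) : ℕ := if u = 1 then 2 * t - 1 else 2 * u

theorem step_cases {a b : ℕ} (t : ℕ) (f : Fin a × Fin b → ℕ) (x : Fin a × Fin b) :
    BKstep t f x = f x ∨
      (((f x = 1 ∧ BKstep t f x = t) ∨ (f x = t ∧ BKstep t f x = 1)) ∧
        ∃ y, Adj x y ∧ (f y = 1 ∨ f y = t)) := by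
  unfold BKstep
  split_ifs with h h1 h2
  · right
    refine ⟨Or.inl ⟨h1, rfl⟩, ?_⟩
    obtain ⟨y, hy, hr⟩ := h
    rcases Relation.ReflTransGen.cases_head hr with h | ⟨c, hc, -⟩
    · exact absurd h.symm hy
    · exact ⟨c, hc.1, hc.2.2⟩
  · right
    refine ⟨Or.inr ⟨h2, rfl⟩, ?_⟩
    obtain ⟨y, hy, hr⟩ := h
    rcases Relation.ReflTransGen.cases_head hr with h | ⟨c, hc, -⟩
    · exact absurd h.symm hy
    · exact ⟨c, hc.1, hc.2.2⟩
  · exact Or.inl rfl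
  · exact Or.inl rfl

theorem step_swap {a b : ℕ} (t : ℕ) (f : Fin a × Fin b → ℕ) (x y : Fin a × Fin b)
    (h : Adj x y) (hx : f x = 1 ∨ f x = t) (hy : f y = 1 ∨ f y = t) :
    BKstep t f x = if f x = 1 then t else 1 := by
  have : ∃ y, y ≠ x ∧ SameRibbon t f x y :=
    ⟨y, adj_ne h, Relation.ReflTransGen.single ⟨h, hx, hy⟩⟩
  unfold BKstep
  rw [if_pos this]
  by_cases h1 : f x = 1
  · simp [h1]
  · have h2 := hx.resolve_left h1
    rw [if_neg h1, if_neg h1, if_pos h2]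

/-- The invariant in force before step `t`. -/
def SweepInv {a b : ℕ} (q t : ℕ) (f : Fin a × Fin b → ℕ) : Prop :=
  (∀ x, 1 ≤ f x ∧ f x ≤ q) ∧ ∀ x y, Cov x y → labKey t (f x) < labKey t (f y)

theorem inv_step {a b : ℕ} (q t : ℕ) (f : Fin a × Fin b → ℕ) (ht : 2 ≤ t) (hq : t ≤ q)
    (h : SweepInv q t f) : SweepInv q (t + 1) (BKstep t f) := by
  obtain ⟨h1, h2⟩ := h
  constructor
  · intro x
    have := h1 x
    rcases step_cases t f x with h | ⟨h | h, -⟩ <;> omega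
  · intro x y hxy
    have hk := h2 x y hxy
    have hx1 := h1 x
    have hy1 := h1 y
    have e1 := step_swap t f x y (cov_adj hxy)
    have e2 := step_swap t f y x (adj_symm' (cov_adj hxy))
    have c1 := step_cases t f x
    have c2 := step_cases t f y
    replace c1 : BKstep t f x = f x ∨ ((f x = 1 ∧ BKstep t f x = t) ∨ (f x = t ∧ BKstep t f x = 1)) :=
      c1.imp_right And.left
    replace c2 : BKstep t f y = f y ∨ ((f y = 1 ∧ BKstep t f y = t) ∨ (f y = t ∧ BKstep t f y = 1)) :=
      c2.imp_right And.left
    generalize BKstep t f x = u at *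
    generalize BKstep t f y = v at *
    generalize f x = m at *
    generalize f y = n at *
    unfold labKey at *
    grind

theorem sweep_succ {a b : ℕ} (t : ℕ) (ht : 2 ≤ t) (f : Fin a × Fin b → ℕ) :
    sweepUpTo (t + 1) f = BKstep t (sweepUpTo t f) := by
  unfold sweepUpTo
  obtain ⟨k, rfl⟩ := Nat.exists_eq_add_of_le ht
  rw [show 2 + k + 1 - 2 = k + 1 by omega, show 2 + k - 2 = k by omega, List.range'_concat]
  simp

theorem sweep_two {a b : ℕ} (f : Fin a × Fin b → ℕ) : sweepUpTo 2 f = f := by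
  simp [sweepUpTo]

theorem inv_sweep {a b q : ℕ} {V : Fin a × Fin b → ℕ} (hV : IncTab a b q V) (t : ℕ)
    (ht : 2 ≤ t) (hq : t ≤ q + 1) : SweepInv q t (sweepUpTo t V) := by
  induction t, ht using Nat.le_induction with
  | base =>
    rw [sweep_two]
    obtain ⟨h1, h2, h3⟩ := hV
    refine ⟨h1, ?_⟩
    rintro ⟨i, j⟩ ⟨i', j'⟩ hc
    have : V (i, j) < V (i', j') := by
      rcases hc with ⟨h, h'⟩ | ⟨h, h'⟩
      · simp only at h h'
        subst h
        exact h2 _ _ _ (by rw [Fin.lt_def]; omega)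
      · simp only at h h'
        subst h
        exact h3 _ _ _ (by rw [Fin.lt_def]; omega)
    have := h1 (i, j)
    have := h1 (i', j')
    unfold labKey
    split_ifs <;> omega
  | succ t ht ih =>
    rw [sweep_succ t ht]
    exact inv_step q t _ ht (by omega) (ih (by omega))

/-- In an adjacent pair of active boxes, the upper-left one carries `1`, the other `t`. -/
theorem inv_pair {a b q t : ℕ} {f : Fin a × Fin b → ℕ} (ht : 2 ≤ t) (h : SweepInv q t f)
    {x y : Fin a × Fin b} (hc : Cov x y) (hx : f x = 1 ∨ f x = t) (hy : f y = 1 ∨ f y = t) :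
    f x = 1 ∧ f y = t := by
  have hk := h.2 x y hc
  unfold labKey at hk
  split_ifs at hk <;> omega

theorem flow_down {a b q : ℕ} {V : Fin a × Fin b → ℕ} (hV : IncTab a b q V)
    (x z : Fin a × Fin b) (hz : Cov x z) (n : ℕ) : ∀ t, 2 ≤ t → t ≤ q + 1 →
    sweepUpTo t V x = 1 → sweepUpTo t V z < t + n → ∃ y, Cov x y ∧ FlowPath q V x y := by
  induction n with
  | zero =>
    intro t ht hq hx hlt
    have hk := (inv_sweep hV t ht hq).2 x z hz
    unfold labKey at hk
    split_ifs at hk <;> omega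
  | succ n ih =>
    intro t ht hq hx hlt
    have hI := inv_sweep hV t ht hq
    have hk := hI.2 x z hz
    have hzq := hI.1 z
    have hzt : t ≤ sweepUpTo t V z ∧ sweepUpTo t V z ≠ 1 := by
      unfold labKey at hk
      split_ifs at hk <;> omega
    by_cases hact : ∃ y, Adj x y ∧ (sweepUpTo t V y = 1 ∨ sweepUpTo t V y = t)
    · obtain ⟨y, hy, hy'⟩ := hact
      rcases (adj_iff_cov x y).1 hy with hc | hc
      · exact ⟨y, hc, hy, t, ht, by omega, Or.inl hx, hy'⟩
      · have := inv_pair ht hI hc hy' (Or.inl hx)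
        omega
    · have hne : sweepUpTo t V z ≠ t := fun h => hact ⟨z, cov_adj hz, Or.inr h⟩
      have ex : sweepUpTo (t + 1) V x = sweepUpTo t V x := by
        rw [sweep_succ t ht]
        exact (step_cases t _ x).resolve_right fun h => hact h.2
      have ez : sweepUpTo (t + 1) V z = sweepUpTo t V z := by
        rw [sweep_succ t ht]
        exact (step_cases t _ z).resolve_right fun h => by omega
      exact ih (t + 1) (by omega) (by omega) (by omega) (by omega)

theorem flow_up {a b q : ℕ} {V : Fin a × Fin b → ℕ} (hV : IncTab a b q V)
    (x : Fin a × Fin b) (hx1 : V x ≠ 1) (t : ℕ) (ht : 2 ≤ t) : t ≤ q + 1 →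
    sweepUpTo t V x = 1 → ∃ y, Cov y x ∧ FlowPath q V y x := by
  induction t, ht using Nat.le_induction with
  | base =>
    intro _ h
    rw [sweep_two] at h
    exact absurd h hx1
  | succ t ht ih =>
    intro hq h
    by_cases h1 : sweepUpTo t V x = 1
    · exact ih (by omega) h1
    have hI := inv_sweep hV t ht (by omega)
    rw [sweep_succ t ht] at h
    rcases step_cases t (sweepUpTo t V) x with h' | ⟨h', y, hy, hy'⟩
    · omega
    · have hxt : sweepUpTo t V x = t := by omega
      rcases (adj_iff_cov x y).1 hy with hc | hc
      · have := inv_pair ht hI hc (Or.inr hxt) hy'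
        omega
      · exact ⟨y, hc, adj_symm' hy, t, ht, by omega, hy', Or.inr hxt⟩

theorem flow_symm {a b q : ℕ} {V : Fin a × Fin b → ℕ} {x y : Fin a × Fin b}
    (h : FlowPath q V x y) : FlowPath q V y x := by
  obtain ⟨h, t, h1, h2, h3, h4⟩ := h
  exact ⟨adj_symm' h, t, h1, h2, h4, h3⟩

theorem cov_pred {a b : ℕ} (ha : 0 < a) (hb : 0 < b) (x : Fin a × Fin b)
    (hx : x ≠ (⟨0, ha⟩, ⟨0, hb⟩)) : ∃ y, Cov y x := by
  obtain ⟨⟨i, hi⟩, ⟨j, hj⟩⟩ := x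
  by_cases h : j = 0
  · have : i ≠ 0 := by
      rintro rfl
      subst h
      exact hx rfl
    exact ⟨(⟨i - 1, by omega⟩, ⟨j, hj⟩), Or.inr ⟨rfl, by simp; omega⟩⟩
  · exact ⟨(⟨i, hi⟩, ⟨j - 1, by omega⟩), Or.inl ⟨rfl, by simp; omega⟩⟩

theorem cov_succ {a b : ℕ} (ha : 0 < a) (hb : 0 < b) (x : Fin a × Fin b)
    (hx : x ≠ (⟨a - 1, Nat.sub_lt ha Nat.one_pos⟩, ⟨b - 1, Nat.sub_lt hb Nat.one_pos⟩)) :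
    ∃ y, Cov x y := by
  obtain ⟨⟨i, hi⟩, ⟨j, hj⟩⟩ := x
  by_cases h : j = b - 1
  · have : i ≠ a - 1 := by
      rintro rfl
      subst h
      exact hx rfl
    exact ⟨(⟨i + 1, by omega⟩, ⟨j, hj⟩), Or.inr ⟨rfl, by simp⟩⟩
  · exact ⟨(⟨i, hi⟩, ⟨j + 1, by omega⟩), Or.inl ⟨rfl, by simp⟩⟩

/-- Let `V ∈ Inc^q(a × b)`. If a box `x ≠ (1,1)` is in the stream-bed of `V`,
then the pair consisting of `x` and the box immediately to its left, or the pair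
consisting of `x` and the box immediately above it, belongs to the flow path of
`V`. Dually, if `x ≠ (a,b)` is in the stream-bed of `V`, then the pair of `x`
with the box immediately to its right, or with the box immediately below it,
belongs to the flow path of `V`. (Corners in 1-based coordinates; here 0-based.) -/
theorem streamBed_flowPath_neighbors (a b : ℕ) (ha : 0 < a) (hb : 0 < b)
    (q : ℕ) (V : Fin a × Fin b → ℕ) (hV : IncTab a b q V) :
    (∀ x : Fin a × Fin b, x ≠ (⟨0, ha⟩, ⟨0, hb⟩) → StreamBed q V x →
      ∃ y : Fin a × Fin b,
        ((y.1 = x.1 ∧ (y.2 : ℕ) + 1 = (x.2 : ℕ)) ∨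
          (y.2 = x.2 ∧ (y.1 : ℕ) + 1 = (x.1 : ℕ))) ∧
        FlowPath q V y x) ∧
    (∀ x : Fin a × Fin b,
      x ≠ (⟨a - 1, Nat.sub_lt ha Nat.one_pos⟩, ⟨b - 1, Nat.sub_lt hb Nat.one_pos⟩) →
      StreamBed q V x →
      ∃ y : Fin a × Fin b,
        ((y.1 = x.1 ∧ (x.2 : ℕ) + 1 = (y.2 : ℕ)) ∨
          (y.2 = x.2 ∧ (x.1 : ℕ) + 1 = (y.1 : ℕ))) ∧
        FlowPath q V x y) := by
  have key0 : ∀ x, StreamBed q V x → ∃ y, FlowPath q V x y := by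
    rintro x ⟨y, h | h⟩
    · exact ⟨y, h⟩
    · exact ⟨y, flow_symm h⟩
  constructor
  · intro x hx hs
    suffices h : ∃ y, Cov y x ∧ FlowPath q V y x by
      obtain ⟨y, hc, hf⟩ := h
      refine ⟨y, ?_, hf⟩
      rcases hc with h | h
      · exact Or.inl ⟨h.1.symm, h.2⟩
      · exact Or.inr ⟨h.1.symm, h.2⟩
    obtain ⟨y, hf⟩ := key0 x hs
    have hf' := hf
    obtain ⟨hadj, t, ht, htq, hx', hy'⟩ := hf'
    have hI := inv_sweep hV t ht (by omega)
    rcases (adj_iff_cov x y).1 hadj with hc | hc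
    · have hp := inv_pair ht hI hc hx' hy'
      obtain ⟨w, hw⟩ := cov_pred ha hb x hx
      have hk := (inv_sweep hV 2 le_rfl (by omega)).2 w x hw
      have hI2 := (inv_sweep hV 2 le_rfl (by omega)).1 w
      rw [sweep_two] at hk hI2
      refine flow_up hV x ?_ t ht (by omega) hp.1
      intro h
      unfold labKey at hk
      split_ifs at hk <;> omega
    · exact ⟨y, hc, flow_symm hf⟩
  · intro x hx hs
    suffices h : ∃ y, Cov x y ∧ FlowPath q V x y from h
    obtain ⟨y, hf⟩ := key0 x hs
    have hf' := hf
    obtain ⟨hadj, t, ht, htq, hx', hy'⟩ := hf'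
    have hI := inv_sweep hV t ht (by omega)
    rcases (adj_iff_cov x y).1 hadj with hc | hc
    · exact ⟨y, hc, hf⟩
    · have hp := inv_pair ht hI hc hy' hx'
      obtain ⟨z, hz⟩ := cov_succ ha hb x hx
      have h1 : sweepUpTo (t + 1) V x = 1 := by
        rw [sweep_succ t ht, step_swap t _ x y hadj hx' hy', if_neg (by omega)]
      exact flow_down hV x z hz (sweepUpTo (t + 1) V z) (t + 1) (by omega) (by omega) h1 (by omega)
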